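/- For every positive integer n and nonnegative integer k ≤ 2, the inequality ∑_{p=1, p≠n}^{∞} p^{4−2k}/(p⁴−n⁴)² ≤ n^{2−2k}/(2n²−2n+1)² holds. -/

import Mathlib

open Filter Topology in
theorem aux_tel (w : ℕ → ℝ) (hw : Tendsto w atTop (𝓝 0)) (M : ℕ) :
    Tendsto (fun N => ∑ p ∈ Finset.range N, (w p - w (p + M))) atTop
      (𝓝 (∑ m ∈ Finset.range M, w m)) := by
  have h1 : ∀ N, ∑ p ∈ Finset.range N, (w p - w (p + M))
      = ∑ m ∈ Finset.range M, w m - ∑ m ∈ Finset.range M, w (N + m) := by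
    intro N
    have e1 := Finset.sum_range_add w N M
    have e2 := Finset.sum_range_add w M N
    rw [Finset.sum_sub_distrib]
    rw [add_comm M N] at e2
    have e3 : ∑ x ∈ Finset.range N, w (M + x) = ∑ x ∈ Finset.range N, w (x + M) :=
      Finset.sum_congr rfl (fun x _ => by rw [add_comm])
    linarith
  simp_rw [h1]
  have h2 : Tendsto (fun N => ∑ m ∈ Finset.range M, w (N + m)) atTop
      (𝓝 (∑ m ∈ Finset.range M, (0 : ℝ))) :=
    tendsto_finsetSum _ (fun m _ => (tendsto_add_atTop_iff_nat m).2 hw)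
  simpa using tendsto_const_nhds.sub h2

theorem aux_a (n : ℕ) : HasSum (fun p : ℕ => 1 / ((p : ℝ) - n) ^ 2)
    (Real.pi ^ 2 / 6 + ∑ m ∈ Finset.range n, 1 / ((m : ℝ) - n) ^ 2) := by
  rw [← hasSum_nat_add_iff n]
  have := hasSum_zeta_two
  simpa using this

theorem aux_b (n : ℕ) : HasSum (fun p : ℕ => 1 / ((p : ℝ) + n) ^ 2)
    (Real.pi ^ 2 / 6 - ∑ m ∈ Finset.range n, 1 / (m : ℝ) ^ 2) := by
  have := (hasSum_nat_add_iff (f := fun p : ℕ => 1 / (p : ℝ) ^ 2)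
    (g := Real.pi ^ 2 / 6 - ∑ m ∈ Finset.range n, 1 / (m : ℝ) ^ 2) n).2
    (by simpa using hasSum_zeta_two)
  simpa using this

theorem aux_ab (n : ℕ) (hn : 1 ≤ n) :
    HasSum (fun p : ℕ => 1 / ((p : ℝ) - n) ^ 2 + 1 / ((p : ℝ) + n) ^ 2)
    (Real.pi ^ 2 / 3 + 1 / (n : ℝ) ^ 2) := by
  convert (aux_a n).add (aux_b n) using 1
  have h := Finset.sum_range_reflect (fun m : ℕ => 1 / (m : ℝ) ^ 2) (n + 1)
  have h' : ∑ m ∈ Finset.range (n+1), 1 / ((m : ℝ) - n) ^ 2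
      = ∑ m ∈ Finset.range (n+1), 1 / (m : ℝ) ^ 2 := by
    rw [← h]
    refine Finset.sum_congr rfl (fun m hm => ?_)
    have : m ≤ n := by simpa [Nat.lt_succ_iff] using hm
    rw [show n + 1 - 1 - m = n - m by omega, Nat.cast_sub this]
    congr 1; ring
  rw [Finset.sum_range_succ, Finset.sum_range_succ] at h'
  simp only [sub_self] at h'
  norm_num at h' ⊢
  linarith

open Filter Topology in
theorem aux_u (n : ℕ) (hn : 1 ≤ n) :
    Summable (fun p : ℕ => 1 / ((p : ℝ) - n) - 1 / ((p : ℝ) + n)) →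
    HasSum (fun p : ℕ => 1 / ((p : ℝ) - n) - 1 / ((p : ℝ) + n)) (- 1 / (n : ℝ)) := by
  intro hs
  have hw : Tendsto (fun p : ℕ => 1 / ((p : ℝ) - n)) atTop (𝓝 0) := by
    have : Tendsto (fun p : ℕ => (p : ℝ) - n) atTop atTop :=
      tendsto_atTop_add_const_right _ _ tendsto_natCast_atTop_atTop
    exact this.inv_tendsto_atTop.congr (fun p => (one_div _).symm)
  have h := aux_tel _ hw (2 * n)
  have e : ∀ p : ℕ, (((p + 2 * n : ℕ) : ℝ) - n) = (p : ℝ) + n := by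
    intro p; push_cast; ring
  simp only [e] at h
  have h3 := tendsto_nhds_unique h hs.hasSum.tendsto_sum_nat
  have hr := Finset.sum_range_reflect (fun m : ℕ => 1 / ((m : ℝ) - n)) (2 * n + 1)
  have hr' : ∑ j ∈ Finset.range (2 * n + 1), 1 / (((2 * n + 1 - 1 - j : ℕ) : ℝ) - n)
      = - ∑ j ∈ Finset.range (2 * n + 1), 1 / ((j : ℝ) - n) := by
    rw [← Finset.sum_neg_distrib]
    refine Finset.sum_congr rfl (fun m hm => ?_)
    have : m ≤ 2 * n := by simpa [Nat.lt_succ_iff] using hm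
    rw [show 2 * n + 1 - 1 - m = 2 * n - m by omega, Nat.cast_sub this, ← one_div_neg_eq_neg_one_div]
    congr 1; push_cast; ring
  rw [hr'] at hr
  rw [Finset.sum_range_succ] at hr
  have e2 : 1 / (((2 * n : ℕ) : ℝ) - n) = 1 / (n : ℝ) := by
    congr 1; push_cast; ring
  rw [e2] at hr
  have : ∑' p : ℕ, (1 / ((p : ℝ) - n) - 1 / ((p : ℝ) + n)) = - 1 / (n : ℝ) := by
    rw [← h3, neg_div]; linarith
  rw [← this]
  exact hs.hasSum

theorem aux_us (n : ℕ) (hn : 1 ≤ n) :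
    Summable (fun p : ℕ => 1 / ((p : ℝ) - n) - 1 / ((p : ℝ) + n)) := by
  have hn' : (1 : ℝ) ≤ n := by exact_mod_cast hn
  rw [← summable_nat_add_iff (n + 1)]
  have hz : Summable (fun p : ℕ => 1 / ((p + 1 : ℕ) : ℝ) ^ 2) :=
    (summable_nat_add_iff 1).2 hasSum_zeta_two.summable
  refine Summable.of_nonneg_of_le (fun p => ?_) (fun p => ?_) (hz.mul_left (2 * (n : ℝ)))
  · push_cast
    have hp : (0 : ℝ) ≤ p := Nat.cast_nonneg p
    rw [sub_nonneg]
    apply one_div_le_one_div_of_le <;> linarith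
  · push_cast
    have hp : (0 : ℝ) ≤ p := Nat.cast_nonneg p
    rw [show (p : ℝ) + (n + 1) - n = p + 1 by ring]
    rw [div_sub_div _ _ (by positivity) (by positivity), mul_one_div,
      div_le_div_iff₀ (by positivity) (by positivity)]
    have h1 : (p : ℝ) + 1 ≤ p + (n + 1) + n := by linarith
    have : 0 ≤ 2 * (n : ℝ) * (p + 1) * ((p : ℝ) + (n + 1) + n - (p + 1)) := by
      apply mul_nonneg; positivity; linarith
    nlinarith

theorem aux_arctan (x y : ℝ) (h : x < y) (hx : 0 ≤ x) :
    (y - x) / (1 + y ^ 2) ≤ Real.arctan y - Real.arctan x := by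
  obtain ⟨c, hc, he⟩ := exists_hasDerivAt_eq_slope Real.arctan (fun t => 1 / (1 + t ^ 2)) h
    Real.continuous_arctan.continuousOn (fun t _ => Real.hasDerivAt_arctan t)
  have hyx : 0 < y - x := by linarith
  rw [eq_div_iff hyx.ne'] at he
  rw [← he, div_eq_mul_one_div, mul_comm]
  have := hc.1
  have := hc.2
  gcongr
  linarith

theorem aux_d (n : ℕ) (hn : 1 ≤ n) :
    ∃ T ≤ 1 / (n : ℝ) ^ 2 + Real.pi / (2 * n),
    HasSum (fun p : ℕ => 1 / ((p : ℝ) ^ 2 + (n : ℝ) ^ 2)) T := by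
  have hn' : (1 : ℝ) ≤ n := by exact_mod_cast hn
  have hb : ∀ N : ℕ, ∑ p ∈ Finset.range (N + 1), 1 / ((p : ℝ) ^ 2 + (n : ℝ) ^ 2)
      ≤ 1 / (n : ℝ) ^ 2 + Real.arctan (N / n) / n := by
    intro N
    induction N with
    | zero => simp
    | succ N ih =>
      rw [Finset.sum_range_succ]
      have h := aux_arctan ((N : ℝ) / n) (((N + 1 : ℕ) : ℝ) / n)
        (by gcongr; simp) (by positivity)
      have e : (((N + 1 : ℕ) : ℝ) / n - (N : ℝ) / n) / (1 + (((N + 1 : ℕ) : ℝ) / n) ^ 2)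
        = n * (1 / (((N + 1 : ℕ) : ℝ) ^ 2 + (n : ℝ) ^ 2)) := by
        push_cast
        field_simp
        ring
      rw [e] at h
      have h2 : 1 / (((N + 1 : ℕ) : ℝ) ^ 2 + (n : ℝ) ^ 2) ≤
        (Real.arctan (((N + 1 : ℕ) : ℝ) / n) - Real.arctan ((N : ℝ) / n)) / n := by
        rw [le_div_iff₀ (by linarith)]; linarith
      rw [sub_div] at h2
      linarith
  have hb2 : ∀ N : ℕ, ∑ p ∈ Finset.range N, 1 / ((p : ℝ) ^ 2 + (n : ℝ) ^ 2)
      ≤ 1 / (n : ℝ) ^ 2 + Real.pi / (2 * n) := by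
    intro N
    refine le_trans (Finset.sum_le_sum_of_subset_of_nonneg
      (Finset.range_mono (Nat.le_succ N)) (fun _ _ _ => by positivity)) ((hb N).trans ?_)
    rw [← div_div]
    gcongr
    exact (Real.arctan_lt_pi_div_two _).le
  have hs := summable_of_sum_range_le (f := fun p : ℕ => 1 / ((p : ℝ) ^ 2 + (n : ℝ) ^ 2))
    (fun p => by positivity) hb2
  exact ⟨_, Real.tsum_le_of_sum_range_le (fun p => by positivity) hb2, hs.hasSum⟩

theorem aux_main (n : ℕ) (hn : 1 ≤ n) (f : ℕ → ℝ) (α β γ : ℝ) (hγ : 0 ≤ γ)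
    (hf0 : ∀ p : ℕ, 1 ≤ p → p ≠ n → 0 ≤ f p)
    (hf : ∀ p : ℕ, 1 ≤ p → p ≠ n → f p ≤
      α * (1 / ((p : ℝ) - n) ^ 2 + 1 / ((p : ℝ) + n) ^ 2)
      + β * (1 / ((p : ℝ) - n) - 1 / ((p : ℝ) + n))
      + γ * (1 / ((p : ℝ) ^ 2 + (n : ℝ) ^ 2))) :
    (∑' p : ℕ, if 1 ≤ p ∧ p ≠ n then f p else 0) ≤
      α * (Real.pi ^ 2 / 3 - 5 / (4 * (n : ℝ) ^ 2)) + β * (3 / (2 * n))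
      + γ * (Real.pi / (2 * n) - 1 / (2 * (n : ℝ) ^ 2)) := by
  have hn' : (1 : ℝ) ≤ n := by exact_mod_cast hn
  obtain ⟨T, hT, hd⟩ := aux_d n hn
  have hG := (((aux_ab n hn).mul_left α).add ((aux_u n hn (aux_us n hn)).mul_left β)).add
    (hd.mul_left γ)
  set G : ℕ → ℝ := fun p => α * (1 / ((p : ℝ) - n) ^ 2 + 1 / ((p : ℝ) + n) ^ 2)
      + β * (1 / ((p : ℝ) - n) - 1 / ((p : ℝ) + n))
      + γ * (1 / ((p : ℝ) ^ 2 + (n : ℝ) ^ 2)) with hGdef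
  have hG2 := (hG.sub (hasSum_ite_eq 0 (G 0))).sub (hasSum_ite_eq n (G n))
  have hle : ∀ p : ℕ, (if 1 ≤ p ∧ p ≠ n then f p else 0) ≤
      G p - (if p = 0 then G 0 else 0) - (if p = n then G n else 0) := by
    intro p
    by_cases h0 : p = 0
    · subst h0
      have : ¬ (0 = n) := by omega
      simp [this]
    · by_cases h1 : p = n
      · subst h1; simp [h0]
      · have : 1 ≤ p := by omega
        simp only [this, h0, h1, if_false, ne_eq, not_false_eq_true, and_self, if_true, sub_zero]
        exact hf p this h1
  have hnn : ∀ p : ℕ, 0 ≤ (if 1 ≤ p ∧ p ≠ n then f p else 0) := by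
    intro p
    split_ifs with h
    · exact hf0 p h.1 h.2
    · exact le_rfl
  have hs := Summable.of_nonneg_of_le hnn hle hG2.summable
  refine (hasSum_le hle hs.hasSum hG2).trans ?_
  have g0 : G 0 = α * (2 / (n : ℝ) ^ 2) + β * (- 2 / n) + γ * (1 / (n : ℝ) ^ 2) := by
    simp only [hGdef]
    push_cast
    have : (n : ℝ) ≠ 0 := by positivity
    rw [zero_sub, zero_add, one_div_neg_eq_neg_one_div]
    field_simp
    ring
  have gn : G n = α * (1 / (4 * (n : ℝ) ^ 2)) + β * (- 1 / (2 * n))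
      + γ * (1 / (2 * (n : ℝ) ^ 2)) := by
    simp only [hGdef, sub_self]
    norm_num
    field_simp
    ring
  rw [g0, gn]
  have := mul_le_mul_of_nonneg_left hT hγ
  have hne : (n : ℝ) ≠ 0 := by positivity
  have e : α * (Real.pi ^ 2 / 3 + 1 / (n : ℝ) ^ 2) + β * (-1 / n)
      + γ * (1 / (n : ℝ) ^ 2 + Real.pi / (2 * n)) -
      (α * (2 / (n : ℝ) ^ 2) + β * (- 2 / n) + γ * (1 / (n : ℝ) ^ 2)) -
      (α * (1 / (4 * (n : ℝ) ^ 2)) + β * (- 1 / (2 * n)) + γ * (1 / (2 * (n : ℝ) ^ 2)))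
      = α * (Real.pi ^ 2 / 3 - 5 / (4 * (n : ℝ) ^ 2)) + β * (3 / (2 * n))
      + γ * (Real.pi / (2 * n) - 1 / (2 * (n : ℝ) ^ 2)) := by
    field_simp
    ring
  linarith

theorem aux_half (n : ℝ) (hn : 1 ≤ n) :
    1 / (4 * n ^ 4) ≤ 1 / (2 * n ^ 2 - 2 * n + 1) ^ 2 := by
  have h0 : 0 < 2 * n ^ 2 - 2 * n + 1 := by nlinarith
  rw [show 4 * n ^ 4 = (2 * n ^ 2) ^ 2 by ring]
  apply one_div_le_one_div_of_le (by positivity)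
  apply pow_le_pow_left₀ h0.le
  linarith

theorem aux_pi : Real.pi ^ 2 ≤ 9.87 := by
  nlinarith [Real.pi_lt_d4, Real.pi_pos]

theorem stmt_13 (n : ℕ) (hn : 1 ≤ n) (k : ℕ) (hk : k ≤ 2) :
    (∑' p : ℕ,
        if 1 ≤ p ∧ p ≠ n then (p : ℝ) ^ (4 - 2 * k) / ((p : ℝ) ^ 4 - (n : ℝ) ^ 4) ^ 2 else 0) ≤
      (n : ℝ) ^ ((2 : ℤ) - 2 * (k : ℤ)) / (2 * (n : ℝ) ^ 2 - 2 * (n : ℝ) + 1) ^ 2 := by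
  have hn' : (1 : ℝ) ≤ n := by exact_mod_cast hn
  have hne : (n : ℝ) ≠ 0 := by positivity
  have hpi := aux_pi
  have hpi2 := Real.pi_lt_d4
  have hhalf := aux_half n hn'
  have hpos : ∀ p : ℕ, 1 ≤ p → p ≠ n →
      0 ≤ (p : ℝ) ^ (4 - 2 * k) / ((p : ℝ) ^ 4 - (n : ℝ) ^ 4) ^ 2 := by
    intro p _ _; positivity
  have hfac : ∀ p : ℕ, (p : ℝ) ^ 4 - (n : ℝ) ^ 4
      = ((p : ℝ) - n) * (p + n) * ((p : ℝ) ^ 2 + (n : ℝ) ^ 2) := fun p => by ring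
  have hnz : ∀ p : ℕ, 1 ≤ p → p ≠ n → (p : ℝ) - n ≠ 0 := by
    intro p _ h h'
    exact h (by exact_mod_cast sub_eq_zero.1 h')
  set x : ℝ := (n : ℝ) with hx
  have hDpos : 0 < 2 * x ^ 2 - 2 * x + 1 := by nlinarith
  interval_cases k
  · refine (aux_main n hn _ (1 / (16 * x ^ 2)) (1 / (16 * x ^ 3)) 0 le_rfl hpos ?_).trans ?_
    · intro p hp hpn
      have h1 := hnz p hp hpn
      have hp' : (1 : ℝ) ≤ p := by exact_mod_cast hp
      rw [hfac, ← hx]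
      generalize (p : ℝ) = y at *
      have h2 : y + x ≠ 0 := by positivity
      have h3 : y ^ 2 + x ^ 2 ≠ 0 := by positivity
      rw [← sub_nonneg]
      have : 1 / (16 * x ^ 2) * (1 / (y - x) ^ 2 + 1 / (y + x) ^ 2)
        + 1 / (16 * x ^ 3) * (1 / (y - x) - 1 / (y + x)) + 0 * (1 / (y ^ 2 + x ^ 2))
        - y ^ (4 - 2 * 0) / ((y - x) * (y + x) * (y ^ 2 + x ^ 2)) ^ 2
        = y ^ 2 / (4 * x ^ 2 * (y ^ 2 + x ^ 2) ^ 2) := by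
        norm_num
        field_simp
        ring
      rw [this]; positivity
    · have : (1 / (16 * x ^ 2)) * (Real.pi ^ 2 / 3 - 5 / (4 * x ^ 2))
          + (1 / (16 * x ^ 3)) * (3 / (2 * x)) + 0 * (Real.pi / (2 * x) - 1 / (2 * x ^ 2))
          ≤ x ^ 2 * (1 / (4 * x ^ 4)) := by
        rw [← sub_nonneg]
        have : x ^ 2 * (1 / (4 * x ^ 4)) - ((1 / (16 * x ^ 2)) * (Real.pi ^ 2 / 3 - 5 / (4 * x ^ 2))
          + (1 / (16 * x ^ 3)) * (3 / (2 * x)) + 0 * (Real.pi / (2 * x) - 1 / (2 * x ^ 2)))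
          = ((12 - Real.pi ^ 2) * x ^ 2 - 3 / 4) / (48 * x ^ 4) := by
          field_simp
          ring
        rw [this]
        apply div_nonneg _ (by positivity)
        nlinarith
      refine this.trans ?_
      have := mul_le_mul_of_nonneg_left hhalf (sq_nonneg x)
      rw [mul_one_div (x ^ 2) ((2 * x ^ 2 - 2 * x + 1) ^ 2)] at this
      simpa using this
  · refine (aux_main n hn _ (1 / (16 * x ^ 4)) (-1 / (16 * x ^ 5)) 0 le_rfl hpos ?_).trans ?_
    · intro p hp hpn
      have h1 := hnz p hp hpn
      have hp' : (1 : ℝ) ≤ p := by exact_mod_cast hp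
      rw [hfac, ← hx]
      generalize (p : ℝ) = y at *
      have h2 : y + x ≠ 0 := by positivity
      have h3 : y ^ 2 + x ^ 2 ≠ 0 := by positivity
      rw [← sub_nonneg]
      have : 1 / (16 * x ^ 4) * (1 / (y - x) ^ 2 + 1 / (y + x) ^ 2)
        + -1 / (16 * x ^ 5) * (1 / (y - x) - 1 / (y + x)) + 0 * (1 / (y ^ 2 + x ^ 2))
        - y ^ (4 - 2 * 1) / ((y - x) * (y + x) * (y ^ 2 + x ^ 2)) ^ 2
        = 1 / (4 * x ^ 2 * (y ^ 2 + x ^ 2) ^ 2) := by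
        norm_num
        field_simp
        ring
      rw [this]; positivity
    · have : (1 / (16 * x ^ 4)) * (Real.pi ^ 2 / 3 - 5 / (4 * x ^ 2))
          + (-1 / (16 * x ^ 5)) * (3 / (2 * x)) + 0 * (Real.pi / (2 * x) - 1 / (2 * x ^ 2))
          ≤ (1 / (4 * x ^ 4)) := by
        rw [← sub_nonneg]
        have : (1 / (4 * x ^ 4)) - ((1 / (16 * x ^ 4)) * (Real.pi ^ 2 / 3 - 5 / (4 * x ^ 2))
          + (-1 / (16 * x ^ 5)) * (3 / (2 * x)) + 0 * (Real.pi / (2 * x) - 1 / (2 * x ^ 2)))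
          = ((12 - Real.pi ^ 2) * x ^ 2 + 33 / 4) / (48 * x ^ 6) := by
          field_simp
          ring
        rw [this]
        apply div_nonneg _ (by positivity)
        nlinarith
      refine this.trans ?_
      simpa using hhalf
  · refine (aux_main n hn _ (1 / (16 * x ^ 6)) (-3 / (16 * x ^ 7)) (1 / (2 * x ^ 6))
      (by positivity) hpos ?_).trans ?_
    · intro p hp hpn
      have h1 := hnz p hp hpn
      have hp' : (1 : ℝ) ≤ p := by exact_mod_cast hp
      rw [hfac, ← hx]
      generalize (p : ℝ) = y at *
      have h2 : y + x ≠ 0 := by positivity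
      have h3 : y ^ 2 + x ^ 2 ≠ 0 := by positivity
      rw [← sub_nonneg]
      have : 1 / (16 * x ^ 6) * (1 / (y - x) ^ 2 + 1 / (y + x) ^ 2)
        + -3 / (16 * x ^ 7) * (1 / (y - x) - 1 / (y + x)) + 1 / (2 * x ^ 6) * (1 / (y ^ 2 + x ^ 2))
        - y ^ (4 - 2 * 2) / ((y - x) * (y + x) * (y ^ 2 + x ^ 2)) ^ 2
        = y ^ 2 / (4 * x ^ 6 * (y ^ 2 + x ^ 2) ^ 2) := by
        norm_num
        field_simp
        ring
      rw [this]; positivity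
    · have e : (1 / (16 * x ^ 6)) * (Real.pi ^ 2 / 3 - 5 / (4 * x ^ 2))
          + (-3 / (16 * x ^ 7)) * (3 / (2 * x))
          + 1 / (2 * x ^ 6) * (Real.pi / (2 * x) - 1 / (2 * x ^ 2))
          = (Real.pi ^ 2 / 12 * x ^ 2 + Real.pi * x - 39 / 16) / (4 * x ^ 8) := by
        field_simp
        ring
      rw [e]
      have e2 : x ^ ((2 : ℤ) - 2 * ((2 : ℕ) : ℤ)) = 1 / x ^ 2 := by
        norm_num
      rw [e2, div_div, div_le_div_iff₀ (by positivity) (by positivity)]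
      have h4 : Real.pi ^ 2 / 12 * x ^ 2 + Real.pi * x - 39 / 16
          ≤ 0.8225 * x ^ 2 + 3.1416 * x - 39 / 16 := by nlinarith
      have h5 : (0.8225 * x ^ 2 + 3.1416 * x - 39 / 16) * (2 * x ^ 2 - 2 * x + 1) ^ 2
          ≤ 4 * x ^ 6 := by
        obtain ⟨m, hm⟩ : ∃ m, x = m + 1 := ⟨x - 1, by ring⟩
        have hm0 : 0 ≤ m := by linarith
        rw [hm, ← sub_nonneg]
        have h8 : 0 ≤ m ^ 4 * (m - 2) ^ 2 := by positivity
        have h9 : 0 ≤ m ^ 2 := by positivity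
        have h10 : 0 ≤ m ^ 3 := by positivity
        have h11 : 0 ≤ m ^ 4 := by positivity
        have h12 : 0 ≤ m ^ 6 := by positivity
        have h13 : 0 ≤ m ^ 5 := by positivity
        ring_nf at h8 ⊢
        linarith
      have h6 := (mul_le_mul_of_nonneg_right h4 (sq_nonneg (2 * x ^ 2 - 2 * x + 1))).trans h5
      have h7 := mul_le_mul_of_nonneg_left h6 (sq_nonneg x)
      nlinarith [h7]
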